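/- For a continuous action of a countable discrete group G on a compact metrizable space X, the generalized type semigroup W(X,G) is almost unperforated (i.e., (n+1)x ≤ ny for some n ∈ ℕ implies x ≤ y) if and only if: for any two finite sequences (A_1,...,A_k) and (B_1,...,B_l) of open sets in X with ⋃_i A_i ⊆ G·(⋃_j B_j) and Σ_i μ(A_i) < Σ_j μ(B_j) for every G-invariant regular premeasure μ with Σ_j μ(B_j) = 1, one has ⨆_i A_i × {i} ≺ ⨆_j B_j × {j}. -/

import Mathlib

open scoped Pointwise NNReal ENNReal

variable {X : Type*} [TopologicalSpace X] {G : Type*} [Group G] [MulAction G X]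

/-- The open support of a continuous `ℝ≥0`-valued function. -/
def osupp (f : C(X, ℝ≥0)) : Set X := {x | f x ≠ 0}

/-- Dynamical subequivalence `A ≼ B` for two finite tuples (lists) of subsets of `X`. -/
def SetSubeq (G : Type*) [Group G] [MulAction G X] (A B : List (Set X)) : Prop :=
  ∀ F : Fin A.length → Set X,
    (∀ i, IsClosed (F i) ∧ F i ⊆ A.get i) →
    ∃ (J : Fin A.length → ℕ)
      (U : (i : Fin A.length) → Fin (J i) → Set X)
      (s : (i : Fin A.length) → Fin (J i) → G)
      (k : (i : Fin A.length) → Fin (J i) → Fin B.length),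
      (∀ i j, IsOpen (U i j)) ∧
      (∀ i, F i ⊆ ⋃ j, U i j) ∧
      (∀ i j, (s i j) • U i j ⊆ B.get (k i j)) ∧
      (∀ (p q : Σ i : Fin A.length, Fin (J i)), p ≠ q → k p.1 p.2 = k q.1 q.2 →
        Disjoint ((s p.1 p.2) • U p.1 p.2) ((s q.1 q.2) • U q.1 q.2))

/-- Dynamical subequivalence `a ≼ b` for tuples of nonnegative continuous functions. -/
def DynSubeq (G : Type*) [Group G] [MulAction G X] (a b : List C(X, ℝ≥0)) : Prop :=
  SetSubeq G (a.map osupp) (b.map osupp)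

/-- The entrywise cut-down `(f - ε)₊`. -/
noncomputable def cutFun (f : C(X, ℝ≥0)) (ε : ℝ≥0) : C(X, ℝ≥0) :=
  ⟨fun x => f x - ε, f.continuous.sub continuous_const⟩

noncomputable def cutList (a : List C(X, ℝ≥0)) (ε : ℝ≥0) : List C(X, ℝ≥0) := a.map (cutFun · ε)

/-- Membership in the algebra of sets generated by the open sets of `X`. -/
def InAlg (X : Type*) [TopologicalSpace X] (s : Set X) : Prop :=
  s ∈ MeasureTheory.generateSetAlgebra {t : Set X | IsOpen t}

/-- A `G`-invariant regular premeasure on the algebra generated by the open sets. -/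
structure InvRegPremeasure (X : Type*) [TopologicalSpace X] (G : Type*) [Group G]
    [MulAction G X] where
  m : Set X → ℝ≥0∞
  junk : ∀ s : Set X, ¬ InAlg X s → m s = 0
  empty' : m ∅ = 0
  countably_additive : ∀ A : ℕ → Set X, (∀ n, InAlg X (A n)) →
    Pairwise (Function.onFun Disjoint A) → InAlg X (⋃ n, A n) →
    m (⋃ n, A n) = ∑' n, m (A n)
  invariant : ∀ (g : G) (s : Set X), InAlg X s → m (g • s) = m s
  inner_regular : ∀ s : Set X, InAlg X s →
    m s = ⨆ (F : Set X) (_ : IsCompact F ∧ F ⊆ s), m F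
  outer_regular : ∀ s : Set X, InAlg X s →
    m s = ⨅ (O : Set X) (_ : IsOpen O ∧ s ⊆ O), m O

/-- A state on the generalized type semigroup `W(X, G)`, described at the level of
`K(X, G)`: a function on tuples which is monotone for `≼`, additive for concatenation,
and vanishes on the empty tuple. -/
structure DynState (X : Type*) [TopologicalSpace X] (G : Type*) [Group G]
    [MulAction G X] where
  toFun : List C(X, ℝ≥0) → ℝ≥0∞
  mono : ∀ a b, DynSubeq G a b → toFun a ≤ toFun b
  additive : ∀ a b, toFun (a ++ b) = toFun a + toFun b
  zero' : toFun [] = 0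

/-- Lower semicontinuity of a state. -/
def DynState.LSC (D : DynState X G) : Prop :=
  ∀ a, D.toFun a = ⨆ (ε : ℝ≥0) (_ : 0 < ε), D.toFun (cutList a ε)

/-- A monotone subadditive functional, homogeneous for natural multiples, on a monoid with a
relation `r`. -/
structure IsGauge {S : Type*} [AddCommMonoid S] (r : S → S → Prop) (p : S → ℝ) : Prop where
  nonneg : ∀ z, 0 ≤ p z
  mono : ∀ z w, r z w → p z ≤ p w
  subadd : ∀ z w, p (z + w) ≤ p z + p w
  homog : ∀ (n : ℕ) z, p (n • z) = n * p z

/-- The reduction of a functional `p` in the direction `a`. -/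
noncomputable def gaugeReduce {S : Type*} [AddCommMonoid S] (p : S → ℝ) (a z : S) : ℝ :=
  ⨅ n : ℕ, (p (z + n • a) - n * p a)

namespace IsGauge

variable {S : Type*} [AddCommMonoid S] {r : S → S → Prop} {p : S → ℝ}

theorem reduce_term_nonneg (hp : IsGauge r p) (hpos : ∀ a, r 0 a)
    (hadd : ∀ a b c, r a b → r (a + c) (b + c)) (a z : S) (n : ℕ) :
    0 ≤ p (z + n • a) - n * p a := by
  have := hp.mono _ _ (hadd 0 z (n • a) (hpos z))
  rw [zero_add, hp.homog] at this
  linarith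

theorem bddBelow_reduce (hp : IsGauge r p) (hpos : ∀ a, r 0 a)
    (hadd : ∀ a b c, r a b → r (a + c) (b + c)) (a z : S) :
    BddBelow (Set.range fun n : ℕ => p (z + n • a) - n * p a) :=
  ⟨0, by rintro _ ⟨n, rfl⟩; exact hp.reduce_term_nonneg hpos hadd a z n⟩

theorem reduce_le_term (hp : IsGauge r p) (hpos : ∀ a, r 0 a)
    (hadd : ∀ a b c, r a b → r (a + c) (b + c)) (a z : S) (n : ℕ) :
    gaugeReduce p a z ≤ p (z + n • a) - n * p a :=
  ciInf_le (hp.bddBelow_reduce hpos hadd a z) n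

theorem reduce_le (hp : IsGauge r p) (hpos : ∀ a, r 0 a)
    (hadd : ∀ a b c, r a b → r (a + c) (b + c)) (a z : S) : gaugeReduce p a z ≤ p z := by
  simpa using hp.reduce_le_term hpos hadd a z 0

theorem reduce (hp : IsGauge r p) (hpos : ∀ a, r 0 a)
    (hadd : ∀ a b c, r a b → r (a + c) (b + c)) (a : S) : IsGauge r (gaugeReduce p a) := by
  have hsub : ∀ z w, gaugeReduce p a (z + w) ≤ gaugeReduce p a z + gaugeReduce p a w := by
    intro z w
    refine le_ciInf_add_ciInf fun n m => ?_
    refine (hp.reduce_le_term hpos hadd a (z + w) (n + m)).trans ?_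
    have h := hp.subadd (z + n • a) (w + m • a)
    rw [show z + n • a + (w + m • a) = z + w + (n + m) • a by rw [add_smul]; abel] at h
    push_cast
    linarith
  have hnn : ∀ z, 0 ≤ gaugeReduce p a z := fun z =>
    le_ciInf fun n => hp.reduce_term_nonneg hpos hadd a z n
  have hle : ∀ (n : ℕ) z, gaugeReduce p a (n • z) ≤ n * gaugeReduce p a z := by
    intro n z
    induction n with
    | zero =>
      have h := hp.reduce_le hpos hadd a (0 • z)
      rw [hp.homog] at h
      simpa using h
    | succ k ih =>
      rw [succ_nsmul]
      refine (hsub _ _).trans ?_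
      push_cast
      linarith
  refine ⟨hnn, fun z w h => ?_, hsub, fun n z => le_antisymm (hle n z) ?_⟩
  · exact ciInf_mono (hp.bddBelow_reduce hpos hadd a z) fun n =>
      sub_le_sub_right (hp.mono _ _ (hadd _ _ _ h)) _
  · rcases Nat.eq_zero_or_pos n with rfl | hn
    · rw [Nat.cast_zero, zero_mul]
      exact hnn _
    refine le_ciInf fun m => ?_
    have h1 := hp.reduce_le_term hpos hadd a z m
    have h2 := hp.homog n (z + m • a)
    have h3 : p (n • (z + m • a)) ≤ p (n • z + m • a) + (n * m - m : ℝ) * p a := by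
      obtain ⟨k, rfl⟩ : ∃ k, n = k + 1 := ⟨n - 1, by omega⟩
      have h4 := hp.subadd ((k + 1) • z + m • a) ((k * m) • a)
      rw [hp.homog (k * m)] at h4
      rw [show (k + 1) • (z + m • a) = (k + 1) • z + m • a + (k * m) • a by
        rw [smul_add, smul_smul, add_assoc, ← add_smul]; congr 2; ring]
      refine h4.trans (le_of_eq ?_)
      push_cast
      ring
    have hn' : (0 : ℝ) ≤ n := Nat.cast_nonneg n
    nlinarith [mul_le_mul_of_nonneg_left h1 hn']

theorem reduce_add_self (hp : IsGauge r p) (hpos : ∀ a, r 0 a)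
    (hadd : ∀ a b c, r a b → r (a + c) (b + c)) (a z : S) :
    gaugeReduce p a (z + a) = gaugeReduce p a z + p a := by
  have key : ∀ n : ℕ, p (z + a + n • a) = p (z + (n + 1) • a) := fun n => by
    rw [succ_nsmul']; congr 1; abel
  apply le_antisymm
  · rw [← sub_le_iff_le_add]
    refine le_ciInf fun n => ?_
    have h1 := hp.reduce_le_term hpos hadd a (z + a) n
    have h2 := hp.subadd (z + n • a) a
    rw [key] at h1
    rw [succ_nsmul, ← add_assoc] at h1
    linarith
  · refine le_ciInf fun n => ?_
    have h1 := hp.reduce_le_term hpos hadd a z (n + 1)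
    rw [key]
    push_cast at h1
    linarith

theorem reduce_add_of_forall (hp : IsGauge r p) (hpos : ∀ a, r 0 a)
    (hadd : ∀ a b c, r a b → r (a + c) (b + c)) (a : S) {x : S} {c : ℝ}
    (hx : ∀ z, p (z + x) = p z + c) (z : S) :
    gaugeReduce p a (z + x) = gaugeReduce p a z + c := by
  unfold gaugeReduce
  rw [ciInf_add (hp.bddBelow_reduce hpos hadd a z)]
  congr 1
  funext n
  rw [add_right_comm, hx]
  ring

theorem iInf {ι : Type*} [Nonempty ι] {P : ι → S → ℝ} (hP : ∀ i, IsGauge r (P i))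
    (hdir : ∀ i j, P i ≤ P j ∨ P j ≤ P i) : IsGauge r fun z => ⨅ i, P i z := by
  have hb : ∀ z, BddBelow (Set.range fun i => P i z) := fun z =>
    ⟨0, by rintro _ ⟨i, rfl⟩; exact (hP i).nonneg z⟩
  refine ⟨fun z => le_ciInf fun i => (hP i).nonneg z,
    fun z w h => ciInf_mono (hb z) fun i => (hP i).mono z w h, fun z w => ?_, fun n z => ?_⟩
  · refine le_ciInf_add_ciInf fun i j => ?_
    rcases hdir i j with h | h
    · exact (ciInf_le (hb _) i).trans (((hP i).subadd z w).trans (by linarith [h w]))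
    · exact (ciInf_le (hb _) j).trans (((hP j).subadd z w).trans (by linarith [h z]))
  · rw [Real.mul_iInf_of_nonneg (Nat.cast_nonneg n)]
    congr 1
    funext i
    exact (hP i).homog n z

/-- A gauge dominates an additive gauge with the same value at a given point. -/
theorem exists_additive_le (hp : IsGauge r p) (hpos : ∀ a, r 0 a)
    (hadd : ∀ a b c, r a b → r (a + c) (b + c)) (x : S) :
    ∃ q : S → ℝ, IsGauge r q ∧ q ≤ p ∧ q x = p x ∧ ∀ z w, q (z + w) = q z + q w := by
  let C : Set (S → ℝ)ᵒᵈ :=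
    {q | IsGauge r (OrderDual.ofDual q) ∧
      ∀ z, OrderDual.ofDual q (z + x) = OrderDual.ofDual q z + p x}
  obtain ⟨q, hq1, ⟨hqg, hqx⟩, hqmax⟩ := zorn_le_nonempty₀ C (by
    intro c hc hchain y hy
    have : Nonempty c := ⟨⟨y, hy⟩⟩
    have hb : ∀ z, BddBelow (Set.range fun i : c => OrderDual.ofDual i.1 z) := fun z =>
      ⟨0, by rintro _ ⟨i, rfl⟩; exact (hc i.2).1.nonneg z⟩
    refine ⟨OrderDual.toDual fun z => ⨅ i : c, OrderDual.ofDual i.1 z, ⟨?_, fun z => ?_⟩, ?_⟩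
    · refine IsGauge.iInf (fun i : c => (hc i.2).1) fun i j => ?_
      exact (hchain.total i.2 j.2).symm
    · simp only [OrderDual.ofDual_toDual]
      rw [ciInf_add (hb z)]
      congr 1
      funext i
      exact (hc i.2).2 z
    · intro w hw z
      exact ciInf_le (hb z) ⟨w, hw⟩)
    (OrderDual.toDual (gaugeReduce p x))
    ⟨hp.reduce hpos hadd x, hp.reduce_add_self hpos hadd x⟩
  have hmin : ∀ a, gaugeReduce (OrderDual.ofDual q) a = OrderDual.ofDual q := by
    intro a
    refine le_antisymm (hqg.reduce_le hpos hadd a) ?_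
    exact hqmax (y := OrderDual.toDual (gaugeReduce (OrderDual.ofDual q) a))
      ⟨hqg.reduce hpos hadd a, hqg.reduce_add_of_forall hpos hadd a hqx⟩
      (hqg.reduce_le hpos hadd a)
  refine ⟨OrderDual.ofDual q, hqg, fun z => ?_, ?_, fun z w => ?_⟩
  · exact (hq1 z).trans (hp.reduce_le hpos hadd x z)
  · have h0 := hqg.homog 0 0
    have h := hqx 0
    simp only [zero_smul, zero_add, Nat.cast_zero, zero_mul] at h0 h
    rw [h, h0, zero_add]
  · have := hqg.reduce_add_self hpos hadd w z
    rwa [hmin] at this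

end IsGauge

/-- The gauge of `z` relative to `y`: the infimum of the fractions `k / m` with `m z ≤ k y`. -/
noncomputable def ratioGauge {S : Type*} [AddCommMonoid S] (r : S → S → Prop) (y z : S) : ℝ :=
  sInf {t : ℝ | ∃ m k : ℕ, 0 < m ∧ r (m • z) (k • y) ∧ t = k / m}

section RatioGauge

variable {S : Type*} [AddCommMonoid S] {r : S → S → Prop}

theorem ratioGauge_le {y z : S} {m k : ℕ} (hm : 0 < m) (h : r (m • z) (k • y)) :
    ratioGauge r y z ≤ k / m :=
  csInf_le ⟨0, by rintro _ ⟨m, k, _, _, rfl⟩; positivity⟩ ⟨m, k, hm, h, rfl⟩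

theorem le_ratioGauge {y z : S} (hy : ∃ m : ℕ, r z (m • y)) {t : ℝ}
    (h : ∀ m k : ℕ, 0 < m → r (m • z) (k • y) → t ≤ k / m) : t ≤ ratioGauge r y z := by
  refine le_csInf ?_ ?_
  · obtain ⟨m, hm⟩ := hy
    exact ⟨_, 1, m, one_pos, by simpa using hm, rfl⟩
  · rintro _ ⟨m, k, hm, hr, rfl⟩
    exact h m k hm hr

theorem relation_nsmul (hrefl : ∀ a, r a a) (hadd : ∀ a b c d, r a b → r c d → r (a + c) (b + d))
    {a b : S} (h : r a b) (n : ℕ) : r (n • a) (n • b) := by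
  induction n with
  | zero => simpa using hrefl 0
  | succ k ih => rw [succ_nsmul, succ_nsmul]; exact hadd _ _ _ _ ih h

theorem isGauge_ratioGauge (hrefl : ∀ a, r a a) (htrans : ∀ a b c, r a b → r b c → r a c)
    (hadd : ∀ a b c d, r a b → r c d → r (a + c) (b + d)) {y : S}
    (hy : ∀ z, ∃ m : ℕ, r z (m • y)) : IsGauge r (ratioGauge r y) := by
  have hnn : ∀ z, 0 ≤ ratioGauge r y z := fun z =>
    le_ratioGauge (hy z) fun m k _ _ => by positivity
  refine ⟨hnn, fun z w h => ?_, fun z w => ?_, fun n z => ?_⟩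
  · refine le_ratioGauge (hy w) fun m k hm hr => ?_
    exact ratioGauge_le hm (htrans _ _ _ (relation_nsmul hrefl hadd h m) hr)
  · rw [← sub_le_iff_le_add]
    refine le_ratioGauge (hy z) fun m k hm hr => ?_
    rw [sub_le_iff_le_add, ← sub_le_iff_le_add']
    refine le_ratioGauge (hy w) fun m' k' hm' hr' => ?_
    rw [sub_le_iff_le_add']
    have h : r ((m * m') • (z + w)) ((k * m' + k' * m) • y) := by
      have h1 := relation_nsmul hrefl hadd hr m'
      have h2 := relation_nsmul hrefl hadd hr' m
      rw [smul_smul, smul_smul] at h1 h2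
      rw [smul_add, add_smul, mul_comm k, mul_comm k']
      refine hadd _ _ _ _ ?_ h2
      rwa [mul_comm m]
    refine (ratioGauge_le (Nat.mul_pos hm hm') h).trans (le_of_eq ?_)
    have : (m : ℝ) ≠ 0 := by positivity
    have : (m' : ℝ) ≠ 0 := by positivity
    push_cast
    field_simp
  · rcases Nat.eq_zero_or_pos n with rfl | hn
    · refine le_antisymm ?_ (by rw [Nat.cast_zero, zero_mul]; exact hnn _)
      have h : r (1 • (0 • z)) (0 • y) := by simpa using hrefl 0
      simpa using ratioGauge_le one_pos h
    have hn' : (0 : ℝ) < n := by positivity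
    apply le_antisymm
    · rw [← div_le_iff₀' hn']
      refine le_ratioGauge (hy z) fun m k hm hr => ?_
      rw [div_le_iff₀' hn']
      have h : r (m • (n • z)) ((n * k) • y) := by
        have := relation_nsmul hrefl hadd hr n
        rwa [smul_smul, smul_smul, mul_comm n m, ← smul_smul] at this
      refine (ratioGauge_le hm h).trans (le_of_eq ?_)
      push_cast
      ring
    · refine le_ratioGauge (hy _) fun m k hm hr => ?_
      rw [smul_smul] at hr
      refine (mul_le_mul_of_nonneg_left (ratioGauge_le (Nat.mul_pos hm hn) hr) hn'.le).trans
        (le_of_eq ?_)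
      have : (m : ℝ) ≠ 0 := by positivity
      push_cast
      field_simp

theorem one_le_ratioGauge (hrefl : ∀ a, r a a) (htrans : ∀ a b c, r a b → r b c → r a c)
    (hpos : ∀ a, r 0 a) (hadd : ∀ a b c d, r a b → r c d → r (a + c) (b + d)) {x y : S}
    (hx : ∃ m : ℕ, r x (m • y)) (h : ∀ n : ℕ, ¬ r ((n + 1) • x) (n • y)) :
    1 ≤ ratioGauge r y x := by
  refine le_ratioGauge hx fun m k hm hr => ?_
  rw [le_div_iff₀ (by positivity), one_mul]
  by_contra! hlt
  have hlt : k < m := by exact_mod_cast hlt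
  obtain ⟨n, rfl⟩ : ∃ n, m = n + 1 := ⟨m - 1, by omega⟩
  obtain ⟨j, rfl⟩ : ∃ j, n = k + j := ⟨n - k, by omega⟩
  refine h _ (htrans _ _ _ hr ?_)
  have := hadd _ _ _ _ (hrefl (k • y)) (hpos (j • y))
  rwa [add_zero, ← add_smul] at this

theorem exists_real_state (hrefl : ∀ a, r a a) (htrans : ∀ a b c, r a b → r b c → r a c)
    (hpos : ∀ a, r 0 a) (hadd : ∀ a b c d, r a b → r c d → r (a + c) (b + d)) {x y : S}
    (hy : ∀ z, ∃ m : ℕ, r z (m • y)) (h : ∀ n : ℕ, ¬ r ((n + 1) • x) (n • y)) :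
    ∃ q : S → ℝ, IsGauge r q ∧ (∀ z w, q (z + w) = q z + q w) ∧ 1 ≤ q x ∧ q y ≤ 1 := by
  obtain ⟨q, hq, hle, hqx, hqa⟩ := (isGauge_ratioGauge hrefl htrans hadd hy).exists_additive_le
    hpos (fun a b c hab => hadd _ _ _ _ hab (hrefl c)) x
  refine ⟨q, hq, hqa, ?_, (hle y).trans ?_⟩
  · rw [hqx]
    exact one_le_ratioGauge hrefl htrans hpos hadd (hy x) h
  · simpa using ratioGauge_le (m := 1) (k := 1) one_pos (hrefl (1 • y))

/-- If `(n + 1) x ≤ n y` fails for every `n`, then some state, possibly infinite outside the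
ideal generated by `y`, takes a value at least `1` at `x` and at most `1` at `y`. -/
theorem exists_state (hrefl : ∀ a, r a a) (htrans : ∀ a b c, r a b → r b c → r a c)
    (hpos : ∀ a, r 0 a) (hadd : ∀ a b c d, r a b → r c d → r (a + c) (b + d)) {x y : S}
    (hx : ∃ m : ℕ, r x (m • y)) (h : ∀ n : ℕ, ¬ r ((n + 1) • x) (n • y)) :
    ∃ D : S →+ ℝ≥0∞, (∀ a b, r a b → D a ≤ D b) ∧ 1 ≤ D x ∧ D y ≤ 1 := by
  classical
  let I : AddSubmonoid S :=
    { carrier := {z | ∃ m : ℕ, r z (m • y)}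
      zero_mem' := ⟨0, by simpa using hrefl 0⟩
      add_mem' := by
        rintro a b ⟨m, hm⟩ ⟨n, hn⟩
        exact ⟨m + n, by rw [add_smul]; exact hadd _ _ _ _ hm hn⟩ }
  have hI : ∀ {a b}, r a b → b ∈ I → a ∈ I := by
    rintro a b hab ⟨m, hm⟩
    exact ⟨m, htrans _ _ _ hab hm⟩
  have hIl : ∀ {a b}, a + b ∈ I → a ∈ I := fun {a b} hab =>
    hI (by simpa using hadd _ _ _ _ (hrefl a) (hpos b)) hab
  have hIr : ∀ {a b}, a + b ∈ I → b ∈ I := fun {a b} hab => hIl (by rwa [add_comm] at hab)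
  have hyI : y ∈ I := ⟨1, by simpa using hrefl y⟩
  obtain ⟨q, hq, hqa, hqx, hqy⟩ := exists_real_state (S := I) (r := fun a b => r a b)
    (x := ⟨x, hx⟩) (y := ⟨y, hyI⟩) (fun a => hrefl a) (fun a b c => htrans a b c)
    (fun a => hpos a) (fun a b c d => hadd a b c d) (fun z => z.2) h
  have hq0 : q 0 = 0 := by simpa using hq.homog 0 0
  refine ⟨⟨⟨fun z => if hz : z ∈ I then ENNReal.ofReal (q ⟨z, hz⟩) else ∞, ?_⟩, ?_⟩, ?_, ?_, ?_⟩
  · rw [dif_pos I.zero_mem]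
    exact ENNReal.ofReal_eq_zero.2 hq0.le
  · intro a b
    by_cases ha : a ∈ I
    · by_cases hb : b ∈ I
      · simp only [dif_pos ha, dif_pos hb, dif_pos (I.add_mem ha hb)]
        rw [← ENNReal.ofReal_add (hq.nonneg _) (hq.nonneg _), ← hqa]
        rfl
      · simp only [dif_neg hb, dif_neg fun hab => hb (hIr hab), add_top]
    · simp only [dif_neg ha, dif_neg fun hab => ha (hIl hab), top_add]
  · intro a b hab
    change (if hz : a ∈ I then _ else _) ≤ (if hz : b ∈ I then _ else _)
    by_cases hb : b ∈ I
    · rw [dif_pos hb, dif_pos (hI hab hb)]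
      exact ENNReal.ofReal_le_ofReal (hq.mono _ _ hab)
    · rw [dif_neg hb]
      exact le_top
  · change 1 ≤ (if hz : x ∈ I then _ else _)
    rw [dif_pos (show x ∈ I from hx)]
    exact ENNReal.one_le_ofReal.2 hqx
  · change (if hz : y ∈ I then _ else _) ≤ _
    rw [dif_pos hyI]
    exact ENNReal.ofReal_le_one.2 hqy

end RatioGauge

/-- A monotone, subadditive, disjointly superadditive and `G`-invariant function on the open sets
of `X`. -/
structure IsOpenValuation (G : Type*) [Group G] [MulAction G X]
    (d : TopologicalSpace.Opens X → ℝ≥0∞) : Prop where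
  mono : Monotone d
  bot : d ⊥ = 0
  sup_le : ∀ U V, d (U ⊔ V) ≤ d U + d V
  le_sup : ∀ U V : TopologicalSpace.Opens X, Disjoint (U : Set X) V → d U + d V ≤ d (U ⊔ V)
  inv : ∀ (g : G) (U V : TopologicalSpace.Opens X), (V : Set X) = g • (U : Set X) → d V = d U

/-- The lower semicontinuous regularization of a function on open sets. -/
noncomputable def innerValue (d : TopologicalSpace.Opens X → ℝ≥0∞) (O : Set X) : ℝ≥0∞ :=
  ⨆ (V : TopologicalSpace.Opens X) (_ : closure (V : Set X) ⊆ O), d V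

theorem le_innerValue (d : TopologicalSpace.Opens X → ℝ≥0∞) {V : TopologicalSpace.Opens X}
    {O : Set X} (h : closure (V : Set X) ⊆ O) : d V ≤ innerValue d O :=
  le_iSup₂ (f := fun (V : TopologicalSpace.Opens X) (_ : closure (V : Set X) ⊆ O) => d V) V h

theorem innerValue_mono (d : TopologicalSpace.Opens X → ℝ≥0∞) {O P : Set X} (h : O ⊆ P) :
    innerValue d O ≤ innerValue d P :=
  iSup₂_le fun _ hV => le_innerValue d (hV.trans h)

theorem innerValue_const_mul (d : TopologicalSpace.Opens X → ℝ≥0∞) (c : ℝ≥0∞) (O : Set X) :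
    innerValue (fun V => c * d V) O = c * innerValue d O := by
  simp only [innerValue, ENNReal.mul_iSup]

namespace IsOpenValuation

variable {d : TopologicalSpace.Opens X → ℝ≥0∞}

theorem const_mul (hd : IsOpenValuation G d) (c : ℝ≥0∞) :
    IsOpenValuation G fun V => c * d V where
  mono _ _ h := mul_le_mul_right (hd.mono h) c
  bot := by rw [hd.bot, mul_zero]
  sup_le U V := by rw [← mul_add]; exact mul_le_mul_right (hd.sup_le U V) c
  le_sup U V h := by rw [← mul_add]; exact mul_le_mul_right (hd.le_sup U V h) c
  inv g U V h := by rw [hd.inv g U V h]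

theorem finset_sup_le (hd : IsOpenValuation G d) {ι : Type*} (T : Finset ι)
    (V : ι → TopologicalSpace.Opens X) : d (T.sup V) ≤ ∑ i ∈ T, d (V i) := by
  classical
  induction T using Finset.induction with
  | empty => simp [hd.bot]
  | insert i T hi ih =>
    rw [Finset.sup_insert, Finset.sum_insert hi]
    exact (hd.sup_le _ _).trans (by gcongr)

theorem innerValue_le (hd : IsOpenValuation G d) (O : TopologicalSpace.Opens X) :
    innerValue d O ≤ d O :=
  iSup₂_le fun _ hV => hd.mono (subset_closure.trans hV)

theorem innerValue_empty (hd : IsOpenValuation G d) : innerValue d ∅ = 0 :=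
  le_antisymm ((hd.innerValue_le ⊥).trans hd.bot.le) zero_le

theorem le_tsum_innerValue [CompactSpace X] [T2Space X] (hd : IsOpenValuation G d) {ι : Type*}
    {O : ι → Set X} (hO : ∀ i, IsOpen (O i)) {V : TopologicalSpace.Opens X}
    (hV : closure (V : Set X) ⊆ ⋃ i, O i) : d V ≤ ∑' i, innerValue d (O i) := by
  obtain ⟨T, hT⟩ := isClosed_closure.isCompact.elim_finite_subcover O hO hV
  obtain ⟨v, hsv, hvo, hv⟩ := exists_subset_iUnion_closure_subset
    (s := closure (V : Set X)) (u := fun i : T => O i) isClosed_closure (fun i => hO i)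
    (fun _ _ => Set.toFinite _) 
    (by rwa [Set.iUnion_subtype (fun i => i ∈ T) fun i => O i])
  let W : T → TopologicalSpace.Opens X := fun i => ⟨v i, hvo i⟩
  calc d V ≤ d (Finset.univ.sup W) := hd.mono fun x hx => by
        obtain ⟨i, hi⟩ := Set.mem_iUnion.1 (hsv (subset_closure hx))
        exact (Finset.le_sup (f := W) (Finset.mem_univ i) : W i ≤ _) hi
    _ ≤ ∑ i : T, d (W i) := hd.finset_sup_le _ _
    _ ≤ ∑ i : T, innerValue d (O i) := Finset.sum_le_sum fun i _ => le_innerValue d (hv i)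
    _ = ∑ i ∈ T, innerValue d (O i) := Finset.sum_coe_sort T fun i => innerValue d (O i)
    _ ≤ _ := ENNReal.sum_le_tsum T

theorem innerValue_iUnion_le [CompactSpace X] [T2Space X] (hd : IsOpenValuation G d) {ι : Type*}
    {O : ι → Set X} (hO : ∀ i, IsOpen (O i)) :
    innerValue d (⋃ i, O i) ≤ ∑' i, innerValue d (O i) :=
  iSup₂_le fun _ hV => hd.le_tsum_innerValue hO hV

theorem innerValue_add_le (hd : IsOpenValuation G d) {U V : Set X} (hUV : Disjoint U V) :
    innerValue d U + innerValue d V ≤ innerValue d (U ∪ V) := by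
  refine ENNReal.biSup_add_biSup_le' ⟨⊥, by simp⟩ ⟨⊥, by simp⟩ fun A hA B hB => ?_
  refine (hd.le_sup A B (hUV.mono (subset_closure.trans hA) (subset_closure.trans hB))).trans ?_
  refine le_innerValue d ?_
  rw [TopologicalSpace.Opens.coe_sup, closure_union]
  exact Set.union_subset_union hA hB

theorem innerValue_smul [ContinuousConstSMul G X] (hd : IsOpenValuation G d) (g : G)
    (O : Set X) : innerValue d (g • O) = innerValue d O := by
  have key : ∀ (g : G) (O : Set X), innerValue d O ≤ innerValue d (g • O) := by
    refine fun g O => iSup₂_le fun V hV => ?_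
    let W : TopologicalSpace.Opens X := ⟨g • (V : Set X), V.isOpen.smul g⟩
    rw [← hd.inv g V W rfl]
    refine le_innerValue d ?_
    change closure (g • (V : Set X)) ⊆ _
    rw [closure_smul]
    exact Set.smul_set_mono hV
  refine le_antisymm ?_ (key g O)
  simpa using key g⁻¹ (g • O)

end IsOpenValuation

theorem inAlg_of_isOpen {s : Set X} (hs : IsOpen s) : InAlg X s :=
  MeasureTheory.self_subset_generateSetAlgebra hs

theorem inAlg_of_isClosed {s : Set X} (hs : IsClosed s) : InAlg X s := by
  rw [← compl_compl s]
  exact MeasureTheory.isSetAlgebra_generateSetAlgebra.compl_mem (inAlg_of_isOpen hs.isOpen_compl)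

theorem InAlg.smul [ContinuousConstSMul G X] {s : Set X} (hs : InAlg X s) (g : G) :
    InAlg X (g • s) := by
  induction hs with
  | base u hu => exact inAlg_of_isOpen (IsOpen.smul hu g)
  | empty => rw [Set.smul_set_empty]; exact inAlg_of_isOpen isOpen_empty
  | compl u _ hu =>
    rw [Set.smul_set_compl]
    exact MeasureTheory.isSetAlgebra_generateSetAlgebra.compl_mem hu
  | union u v _ _ hu hv =>
    rw [Set.smul_set_union]
    exact MeasureTheory.isSetAlgebra_generateSetAlgebra.union_mem hu hv

theorem InAlg.measurableSet [MeasurableSpace X] [BorelSpace X] {s : Set X} (hs : InAlg X s) :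
    MeasurableSet s := by
  induction hs with
  | base u hu => exact IsOpen.measurableSet hu
  | empty => exact MeasurableSet.empty
  | compl u _ hu => exact hu.compl
  | union u v _ _ hu hv => exact hu.union hv

/-- A Borel measure on a compact metrizable space for which every point of finite measure has a
neighbourhood of finite measure is inner regular with respect to compact sets. -/
theorem exists_isCompact_lt_measure [CompactSpace X] [TopologicalSpace.MetrizableSpace X]
    [MeasurableSpace X] [BorelSpace X] (μ : MeasureTheory.Measure X)
    (hμ : ∀ x, μ {x} < ∞ → ∃ O : Set X, IsOpen O ∧ x ∈ O ∧ μ O < ∞)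
    {E : Set X} (hE : MeasurableSet E) {c : ℝ≥0∞} (hc : c < μ E) :
    ∃ K, IsCompact K ∧ K ⊆ E ∧ c < μ K := by
  by_cases h : ∃ x ∈ E, μ {x} = ∞
  · obtain ⟨x, hx, hxt⟩ := h
    exact ⟨{x}, isCompact_singleton, Set.singleton_subset_iff.2 hx, hxt ▸ hc.trans_le le_top⟩
  push Not at h
  have hfin : ∀ x : E, ∃ O : Set X, IsOpen O ∧ x.1 ∈ O ∧ μ O < ∞ := fun x =>
    hμ x.1 (h x.1 x.2).lt_top
  choose O hO hxO hOμ using hfin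
  obtain ⟨T, hT, hTO⟩ := TopologicalSpace.isOpen_iUnion_countable O hO
  have hcover : E = ⋃ t ∈ T, E ∩ O t := by
    rw [← Set.inter_iUnion₂, hTO]
    exact (Set.inter_eq_left.2 fun x hx => Set.mem_iUnion.2 ⟨⟨x, hx⟩, hxO ⟨x, hx⟩⟩).symm
  have : Countable T := hT.to_subtype
  have hsup : μ E = ⨆ s : Finset T, μ (⋃ t ∈ s, E ∩ O t) := by
    conv_lhs => rw [hcover]
    rw [Set.biUnion_eq_iUnion]
    rw [Set.iUnion_eq_iUnion_finset]
    refine Directed.measure_iUnion (Monotone.directed_le fun s t hst => ?_)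
    exact Set.biUnion_subset_biUnion_left hst
  rw [hsup, lt_iSup_iff] at hc
  obtain ⟨s, hs⟩ := hc
  set W : Set X := ⋃ t ∈ s, E ∩ O t with hW
  have hWm : MeasurableSet W :=
    Finset.measurableSet_biUnion _ fun t _ => hE.inter (hO t).measurableSet
  have hWfin : μ W ≠ ∞ := by
    refine ne_of_lt ((MeasureTheory.measure_biUnion_finset_le s _).trans_lt ?_)
    exact ENNReal.sum_lt_top.2 fun t _ =>
      (MeasureTheory.measure_mono Set.inter_subset_right).trans_lt (hOμ t)
  have : Fact (μ W < ∞) := ⟨hWfin.lt_top⟩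
  have hWr : c < (μ.restrict W) W := by rwa [MeasureTheory.Measure.restrict_apply_self]
  obtain ⟨K, hKW, hK, hcK⟩ := hWm.exists_lt_isCompact hWr
  refine ⟨K, hK, hKW.trans (Set.iUnion₂_subset fun t _ => Set.inter_subset_left), ?_⟩
  exact hcK.trans_le (MeasureTheory.Measure.restrict_apply_le _ _)

/-- An open valuation on a compact metrizable space induces an invariant regular premeasure which
agrees on open sets with the lower semicontinuous regularization of the valuation. -/
theorem IsOpenValuation.exists_invRegPremeasure [CompactSpace X] [T2Space X]
    [TopologicalSpace.MetrizableSpace X] [ContinuousConstSMul G X]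
    {d : TopologicalSpace.Opens X → ℝ≥0∞} (hd : IsOpenValuation G d) :
    ∃ μ : InvRegPremeasure X G, ∀ O, IsOpen O → μ.m O = innerValue d O := by
  classical
  let _ : MeasurableSpace X := borel X
  have _ : BorelSpace X := ⟨rfl⟩
  let om : MeasureTheory.OuterMeasure X :=
    MeasureTheory.inducedOuterMeasure (fun (s : Set X) (_ : IsOpen s) => innerValue d s)
      isOpen_empty hd.innerValue_empty
  have msU : ∀ ⦃f : ℕ → Set X⦄ (hm : ∀ i, IsOpen (f i)),
      innerValue d (⋃ i, f i) ≤ ∑' i, innerValue d (f i) := fun f hf => hd.innerValue_iUnion_le hf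
  have hmono : ∀ ⦃s₁ s₂ : Set X⦄, IsOpen s₁ → IsOpen s₂ → s₁ ⊆ s₂ →
      innerValue d s₁ ≤ innerValue d s₂ := fun _ _ _ _ h => innerValue_mono d h
  have hom : ∀ O, IsOpen O → om O = innerValue d O := fun O hO =>
    MeasureTheory.inducedOuterMeasure_eq' (fun _ => isOpen_iUnion) msU hmono hO
  have hinf : ∀ s, om s = ⨅ (O : Set X) (_ : IsOpen O) (_ : s ⊆ O), innerValue d O :=
    MeasureTheory.inducedOuterMeasure_eq_iInf (fun _ => isOpen_iUnion) msU hmono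
  have hcar : ‹MeasurableSpace X› ≤ om.caratheodory := by
    refine MeasurableSpace.generateFrom_le fun O hO => ?_
    have hO : IsOpen O := hO
    refine (MeasureTheory.inducedOuterMeasure_caratheodory (fun _ => isOpen_iUnion) msU hmono
      O).2 fun t ht => ?_
    change om (t ∩ O) + om (t \ O) ≤ om t
    rw [hom _ (ht.inter hO), hom _ ht, innerValue, ENNReal.biSup_add' ⟨⊥, by simp⟩]
    refine iSup₂_le fun V hV => ?_
    obtain ⟨W, hWo, hVW, hW⟩ := normal_exists_closure_subset isClosed_closure (ht.inter hO) hV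
    have hdiff : om (t \ O) ≤ innerValue d (t \ closure W) := by
      rw [← hom _ (ht.sdiff isClosed_closure)]
      exact om.mono (Set.sdiff_subset_sdiff_right (hW.trans Set.inter_subset_right))
    refine (add_le_add (le_innerValue d hVW) hdiff).trans ?_
    refine (hd.innerValue_add_le ?_).trans (innerValue_mono d ?_)
    · exact Set.disjoint_left.2 fun x hx hx' => hx'.2 (subset_closure hx)
    · exact Set.union_subset (subset_closure.trans (hW.trans Set.inter_subset_left))
        Set.sdiff_subset
  let μ : MeasureTheory.Measure X := om.toMeasure hcar
  have hμ : ∀ s, MeasurableSet s → μ s = om s := fun s hs =>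
    MeasureTheory.toMeasure_apply om hcar hs
  have hμO : ∀ O, IsOpen O → μ O = innerValue d O := fun O hO => by
    rw [hμ _ hO.measurableSet, hom _ hO]
  have houter : ∀ s, MeasurableSet s → μ s = ⨅ (O : Set X) (_ : IsOpen O ∧ s ⊆ O), μ O := by
    intro s hs
    rw [hμ _ hs, hinf]
    refine iInf_congr fun O => ?_
    rw [iInf_and]
    exact iInf_congr fun hO => by rw [hμO _ hO]
  have hloc : ∀ x, μ {x} < ∞ → ∃ O : Set X, IsOpen O ∧ x ∈ O ∧ μ O < ∞ := by
    intro x hx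
    rw [houter _ (measurableSet_singleton x)] at hx
    simp only [iInf_lt_iff] at hx
    obtain ⟨O, ⟨hO, hxO⟩, hlt⟩ := hx
    exact ⟨O, hO, hxO rfl, hlt⟩
  refine ⟨{ m := fun s => if InAlg X s then μ s else 0
            junk := fun s hs => if_neg hs
            empty' := by simp
            countably_additive := ?_
            invariant := ?_
            inner_regular := ?_
            outer_regular := ?_ }, fun O hO => ?_⟩
  · intro A hA hdisj hU
    rw [if_pos hU, MeasureTheory.measure_iUnion hdisj fun n => (hA n).measurableSet]
    exact tsum_congr fun n => (if_pos (hA n)).symm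
  · intro g s hs
    rw [if_pos hs, if_pos (hs.smul g), hμ _ hs.measurableSet, hμ _ (hs.smul g).measurableSet]
    rw [← inv_inv g, ← Set.preimage_smul]
    refine MeasureTheory.inducedOuterMeasure_preimage (fun _ => isOpen_iUnion) msU hmono
      (MulAction.toPerm g⁻¹) (fun O => ?_) (fun O hO => ?_)
    · exact (Homeomorph.smul g⁻¹).isOpen_preimage
    · change innerValue d ((fun x => g⁻¹ • x) ⁻¹' O) = _
      rw [Set.preimage_smul, inv_inv, hd.innerValue_smul]
  · intro s hs
    rw [if_pos hs]
    apply le_antisymm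
    · refine le_of_forall_lt fun c hc => ?_
      obtain ⟨K, hK, hKs, hcK⟩ := exists_isCompact_lt_measure μ hloc hs.measurableSet hc
      refine hcK.trans_le ?_
      rw [← if_pos (c := InAlg X K) (inAlg_of_isClosed hK.isClosed) (t := μ K) (e := 0)]
      exact le_iSup₂ (f := fun (F : Set X) (_ : IsCompact F ∧ F ⊆ s) =>
        if InAlg X F then μ F else 0) K ⟨hK, hKs⟩
    · refine iSup₂_le fun K hK => ?_
      split_ifs
      · exact MeasureTheory.measure_mono hK.2
      · exact zero_le
  · intro s hs
    rw [if_pos hs, houter _ hs.measurableSet]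
    refine iInf_congr fun O => iInf_congr fun hO => ?_
    rw [if_pos (inAlg_of_isOpen hO.1)]
  · change (if InAlg X O then μ O else 0) = _
    rw [if_pos (inAlg_of_isOpen hO), hμO _ hO]

/-- Dynamical subequivalence of families of subsets of `X` indexed by arbitrary types. -/
def FamSubeq (G : Type*) [Group G] [MulAction G X] {ι κ : Type} (A : ι → Set X)
    (B : κ → Set X) : Prop :=
  ∀ F : ι → Set X, (∀ i, IsClosed (F i) ∧ F i ⊆ A i) →
    ∃ (J : ι → Type) (_ : ∀ i, Finite (J i)) (U : ∀ i, J i → Set X) (s : ∀ i, J i → G)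
      (k : ∀ i, J i → κ),
      (∀ i j, IsOpen (U i j)) ∧ (∀ i, F i ⊆ ⋃ j, U i j) ∧ (∀ i j, s i j • U i j ⊆ B (k i j)) ∧
      ∀ (p q : Σ i, J i) (x : X), k p.1 p.2 = k q.1 q.2 →
        x ∈ s p.1 p.2 • U p.1 p.2 → x ∈ s q.1 q.2 • U q.1 q.2 → p = q

section FamSubeq

variable {ι κ l : Type} {A : ι → Set X} {B : κ → Set X} {C : l → Set X}

theorem famSubeq_of_pieces (J : ι → Type) [hJ : ∀ i, Finite (J i)] (U : ∀ i, J i → Set X)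
    (s : ∀ i, J i → G) (k : ∀ i, J i → κ) (hU : ∀ i j, IsOpen (U i j))
    (hA : ∀ i, A i ⊆ ⋃ j, U i j) (hB : ∀ i j, s i j • U i j ⊆ B (k i j))
    (hd : ∀ (p q : Σ i, J i) (x : X), k p.1 p.2 = k q.1 q.2 →
        x ∈ s p.1 p.2 • U p.1 p.2 → x ∈ s q.1 q.2 • U q.1 q.2 → p = q) : FamSubeq G A B :=
  fun _ hF => ⟨J, hJ, U, s, k, hU, fun i => (hF i).2.trans (hA i), hB, hd⟩

theorem famSubeq_of_smul (hA : ∀ i, IsOpen (A i)) (e : ι → κ) (he : Function.Injective e)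
    (g : ι → G) (h : ∀ i, g i • A i ⊆ B (e i)) : FamSubeq G A B := by
  refine famSubeq_of_pieces (fun _ => Unit) (fun i _ => A i) (fun i _ => g i) (fun i _ => e i)
    (fun i _ => hA i) (fun i => (Set.iUnion_const (A i)).ge) (fun i _ => h i) ?_
  rintro ⟨i, ⟨⟩⟩ ⟨j, ⟨⟩⟩ x hij _ _
  cases he hij
  rfl

theorem famSubeq_of_subset (hA : ∀ i, IsOpen (A i)) (e : ι → κ) (he : Function.Injective e)
    (h : ∀ i, A i ⊆ B (e i)) : FamSubeq G A B :=
  famSubeq_of_smul hA e he 1 fun i => by simpa using h i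

theorem FamSubeq.trans [Finite ι] [CompactSpace X] [T2Space X] [ContinuousConstSMul G X]
    (hAB : FamSubeq G A B) (hBC : FamSubeq G B C) : FamSubeq G A C := by
  intro F hF
  obtain ⟨J, hJ, U, s, k, hU, hFU, hUB, hd⟩ := hAB F hF
  have hK : ∀ i, ∃ v : J i → Set X, F i ⊆ ⋃ j, v j ∧ (∀ j, IsClosed (v j)) ∧ ∀ j, v j ⊆ U i j :=
    fun i => exists_subset_iUnion_closed_subset (hF i).1 (hU i) (fun _ _ => Set.toFinite _) (hFU i)
  choose K hFK hKc hKU using hK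
  let H : κ → Set X := fun c => ⋃ p : {p : Σ i, J i // k p.1 p.2 = c}, s p.1.1 p.1.2 • K p.1.1 p.1.2
  obtain ⟨J', hJ', V, t, m, hV, hHV, hVC, hd'⟩ := hBC H (by
    refine fun c => ⟨isClosed_iUnion_of_finite fun p => (hKc _ _).smul _, ?_⟩
    refine Set.iUnion_subset ?_
    rintro ⟨p, rfl⟩
    exact (Set.smul_set_mono (hKU _ _)).trans (hUB _ _))
  refine ⟨fun i => Σ j : J i, J' (k i j), fun i => inferInstance,
    fun i j => U i j.1 ∩ (fun x => s i j.1 • x) ⁻¹' V _ j.2, fun i j => t _ j.2 * s i j.1,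
    fun i j => m _ j.2, fun i j => ?_, fun i x hx => ?_, fun i j => ?_, ?_⟩
  · exact (hU _ _).inter ((hV _ _).preimage (continuous_const_smul _))
  · obtain ⟨j, hj⟩ := Set.mem_iUnion.1 (hFK i hx)
    have hxH : s i j • x ∈ H (k i j) :=
      Set.mem_iUnion.2 ⟨⟨⟨i, j⟩, rfl⟩, Set.smul_mem_smul_set hj⟩
    obtain ⟨r, hr⟩ := Set.mem_iUnion.1 (hHV _ hxH)
    exact Set.mem_iUnion.2 ⟨⟨j, r⟩, hKU _ _ hj, hr⟩
  · rintro _ ⟨x, ⟨_, hx⟩, rfl⟩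
    change (_ * _) • x ∈ _
    rw [mul_smul]
    exact hVC _ _ (Set.smul_mem_smul_set hx)
  · rintro ⟨i, j, r⟩ ⟨i', j', r'⟩ x hm ⟨y, ⟨hyU, hyV⟩, rfl⟩ ⟨z, ⟨hzU, hzV⟩, hzy⟩
    dsimp only at hm hyU hyV hzU hzV hzy
    rw [mul_smul, mul_smul] at hzy
    have h1 : (⟨k i j, r⟩ : Σ c, J' c) = ⟨k i' j', r'⟩ := by
      refine hd' _ _ (t _ r • s i j • y) hm (Set.smul_mem_smul_set hyV) ?_
      rw [← hzy]
      exact Set.smul_mem_smul_set hzV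
    have hk : k i j = k i' j' := congrArg Sigma.fst h1
    have ht : t _ r = t _ r' := congrArg (fun p : Σ c, J' c => t p.1 p.2) h1
    rw [ht] at hzy
    have h2 : (⟨i, j⟩ : Σ i, J i) = ⟨i', j'⟩ := by
      refine hd _ _ (s i j • y) hk (Set.smul_mem_smul_set hyU) ?_
      rw [← smul_left_cancel _ hzy]
      exact Set.smul_mem_smul_set hzU
    cases h2
    cases h1
    rfl

theorem FamSubeq.sum {ι' κ' : Type} {A : ι ⊕ ι' → Set X} {B : κ ⊕ κ' → Set X}
    (h : FamSubeq G (fun i => A (Sum.inl i)) fun j => B (Sum.inl j))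
    (h' : FamSubeq G (fun i => A (Sum.inr i)) fun j => B (Sum.inr j)) : FamSubeq G A B := by
  intro F hF
  obtain ⟨J, hJ, U, s, k, hU, hFU, hUB, hd⟩ := h _ fun i => hF (Sum.inl i)
  obtain ⟨J', hJ', U', s', k', hU', hFU', hUB', hd'⟩ := h' _ fun i => hF (Sum.inr i)
  refine ⟨Sum.elim J J', ?_, fun i => Sum.rec U U' i, fun i => Sum.rec s s' i,
    fun i => Sum.rec (fun i j => Sum.inl (k i j)) (fun i j => Sum.inr (k' i j)) i, ?_, ?_, ?_, ?_⟩
  · rintro (i | i)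
    exacts [hJ i, hJ' i]
  · rintro (i | i)
    exacts [hU i, hU' i]
  · rintro (i | i)
    exacts [hFU i, hFU' i]
  · rintro (i | i)
    exacts [hUB i, hUB' i]
  · rintro ⟨i | i, a⟩ ⟨j | j, b⟩ x hk hxa hxb
    · cases hd ⟨i, a⟩ ⟨j, b⟩ x (Sum.inl_injective hk) hxa hxb
      rfl
    · cases hk
    · cases hk
    · cases hd' ⟨i, a⟩ ⟨j, b⟩ x (Sum.inr_injective hk) hxa hxb
      rfl

theorem famSubeq_congr [Finite ι] [CompactSpace X] [T2Space X] [ContinuousConstSMul G X]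
    {ι' κ' : Type} {A' : ι' → Set X} {B' : κ' → Set X} (hA : ∀ i, IsOpen (A i))
    (hB : ∀ j, IsOpen (B j)) (e : ι ≃ ι') (f : κ ≃ κ') (he : ∀ i, A' (e i) = A i)
    (hf : ∀ j, B' (f j) = B j) : FamSubeq G A B ↔ FamSubeq G A' B' := by
  have : Finite ι' := Finite.of_equiv ι e
  have he' : ∀ i, A (e.symm i) = A' i := fun i => by rw [← he, e.apply_symm_apply]
  have hf' : ∀ j, B (f.symm j) = B' j := fun j => by rw [← hf, f.apply_symm_apply]
  have hA' : ∀ i, IsOpen (A' i) := fun i => he' i ▸ hA _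
  have hB' : ∀ j, IsOpen (B' j) := fun j => hf' j ▸ hB _
  constructor
  · intro h
    exact (famSubeq_of_subset hA' e.symm e.symm.injective fun i => (he' i).ge).trans
      (h.trans (famSubeq_of_subset hB f f.injective fun j => (hf j).ge))
  · intro h
    exact (famSubeq_of_subset hA e e.injective fun i => (he i).ge).trans
      (h.trans (famSubeq_of_subset hB' f.symm f.symm.injective fun j => (hf' j).ge))

theorem setSubeq_iff_famSubeq (A B : List (Set X)) :
    SetSubeq G A B ↔ FamSubeq G A.get B.get := by
  constructor
  · intro h F hF
    obtain ⟨J, U, s, k, hU, hFU, hUB, hd⟩ := h F hF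
    refine ⟨fun i => Fin (J i), fun _ => inferInstance, U, s, k, hU, hFU, hUB, ?_⟩
    intro p q x hk hp hq
    by_contra hpq
    exact Set.disjoint_left.1 (hd p q hpq hk) hp hq
  · intro h F hF
    obtain ⟨J, hJ, U, s, k, hU, hFU, hUB, hd⟩ := h F hF
    let e : ∀ i, J i ≃ Fin (Nat.card (J i)) := fun i => Finite.equivFin (J i)
    refine ⟨fun i => Nat.card (J i), fun i j => U i ((e i).symm j), fun i j => s i ((e i).symm j),
      fun i j => k i ((e i).symm j), fun i j => hU _ _, fun i x hx => ?_, fun i j => hUB _ _, ?_⟩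
    · obtain ⟨j, hj⟩ := Set.mem_iUnion.1 (hFU i hx)
      exact Set.mem_iUnion.2 ⟨e i j, by
        change x ∈ U i ((e i).symm (e i j))
        rwa [Equiv.symm_apply_apply]⟩
    · rintro ⟨i, a⟩ ⟨j, b⟩ hpq hk
      refine Set.disjoint_left.2 fun x hx hy => hpq ?_
      have := hd ⟨i, (e i).symm a⟩ ⟨j, (e j).symm b⟩ x hk hx hy
      obtain ⟨rfl, h2⟩ := Sigma.mk.inj_iff.1 this
      rw [(e i).symm.injective (eq_of_heq h2)]

end FamSubeq

/-- The multiset of values of a finite family. -/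
def familyMultiset {α : Type*} {ι : Type} [Fintype ι] (A : ι → α) : Multiset α := ∑ i, {A i}

theorem familyMultiset_eq_map {α : Type*} {ι : Type} [Fintype ι] (A : ι → α) :
    familyMultiset A = Finset.univ.val.map A := by
  rw [familyMultiset, Finset.sum, ← Multiset.sum_map_singleton (Finset.univ.val.map A),
    Multiset.map_map]
  rfl

theorem familyMultiset_get {α : Type*} (a : List α) : familyMultiset a.get = (a : Multiset α) := by
  rw [familyMultiset_eq_map, Fin.univ_val_map, List.ofFn_get]

theorem familyMultiset_toList_get {α : Type*} (M : Multiset α) :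
    familyMultiset M.toList.get = M := by
  rw [familyMultiset_get, Multiset.coe_toList]

theorem familyMultiset_sumElim {α : Type*} {ι κ : Type} [Fintype ι] [Fintype κ] (A : ι → α)
    (B : κ → α) : familyMultiset (Sum.elim A B) = familyMultiset A + familyMultiset B := by
  simp [familyMultiset]

theorem exists_equiv_of_familyMultiset_eq {α : Type*} {ι κ : Type} [Fintype ι] [Fintype κ]
    {A : ι → α} {B : κ → α} (h : familyMultiset A = familyMultiset B) :
    ∃ e : ι ≃ κ, ∀ i, B (e i) = A i := by
  classical
  have hcard : ∀ a, Fintype.card {i // A i = a} = Fintype.card {j // B j = a} := by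
    intro a
    have := congrArg (Multiset.count a) h
    simp only [familyMultiset, Multiset.count_sum', Multiset.count_singleton] at this
    rw [Fintype.card_subtype, Fintype.card_subtype]
    simpa [Finset.sum_boole, eq_comm] using this
  let e := Equiv.ofFiberEquiv fun a => Fintype.equivOfCardEq (hcard a)
  exact ⟨e, fun i => Equiv.ofFiberEquiv_map _ i⟩

/-- Dynamical subequivalence of multisets of open sets. -/
def TypeLE (G : Type*) [Group G] [MulAction G X] (M N : Multiset (TopologicalSpace.Opens X)) :
    Prop :=
  FamSubeq G (fun i => (M.toList.get i : Set X)) fun j => (N.toList.get j : Set X)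

section TypeLE

theorem typeLE_refl (M : Multiset (TopologicalSpace.Opens X)) : TypeLE G M M :=
  famSubeq_of_subset (fun _ => TopologicalSpace.Opens.isOpen _) id Function.injective_id
    fun _ => subset_rfl

variable [CompactSpace X] [T2Space X] [ContinuousConstSMul G X]

theorem typeLE_iff {ι κ : Type} [Fintype ι] [Fintype κ] (A : ι → TopologicalSpace.Opens X)
    (B : κ → TopologicalSpace.Opens X) :
    TypeLE G (familyMultiset A) (familyMultiset B) ↔
      FamSubeq G (fun i => (A i : Set X)) fun j => (B j : Set X) := by
  obtain ⟨e, he⟩ := exists_equiv_of_familyMultiset_eq (familyMultiset_toList_get (familyMultiset A))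
  obtain ⟨f, hf⟩ := exists_equiv_of_familyMultiset_eq (familyMultiset_toList_get (familyMultiset B))
  exact famSubeq_congr (fun i => (TopologicalSpace.Opens.isOpen _))
    (fun i => (TopologicalSpace.Opens.isOpen _)) e f (fun i => by rw [he]) fun j => by rw [hf]

theorem TypeLE.trans {M N P : Multiset (TopologicalSpace.Opens X)} (h : TypeLE G M N)
    (h' : TypeLE G N P) : TypeLE G M P :=
  FamSubeq.trans h h'

theorem typeLE_zero (M : Multiset (TopologicalSpace.Opens X)) : TypeLE G 0 M := by
  rw [show (0 : Multiset (TopologicalSpace.Opens X)) = familyMultiset Empty.elim by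
      simp [familyMultiset], ← familyMultiset_toList_get M, typeLE_iff]
  exact famSubeq_of_subset (fun i => i.elim) (fun i => i.elim) (fun i => i.elim) fun i => i.elim

theorem TypeLE.add {M N P Q : Multiset (TopologicalSpace.Opens X)} (h : TypeLE G M N)
    (h' : TypeLE G P Q) : TypeLE G (M + P) (N + Q) := by
  rw [← familyMultiset_toList_get M, ← familyMultiset_toList_get N,
    ← familyMultiset_toList_get P, ← familyMultiset_toList_get Q, ← familyMultiset_sumElim,
    ← familyMultiset_sumElim, typeLE_iff]
  exact FamSubeq.sum h h'

theorem typeLE_singleton_of_smul {U V : TopologicalSpace.Opens X} (g : G)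
    (h : g • (U : Set X) ⊆ V) : TypeLE G {U} {V} := by
  have := (typeLE_iff (G := G) (fun _ : Unit => U) (fun _ : Unit => V)).2
    (famSubeq_of_smul (fun _ => U.isOpen) id Function.injective_id (fun _ => g) fun _ => h)
  simpa [familyMultiset] using this

theorem typeLE_singleton_of_le {U V : TopologicalSpace.Opens X} (h : U ≤ V) :
    TypeLE G {U} {V} :=
  typeLE_singleton_of_smul (1 : G) (by simpa using h)

theorem typeLE_singleton_bot : TypeLE G {(⊥ : TopologicalSpace.Opens X)} 0 := by
  have := (typeLE_iff (G := G) (fun _ : Unit => (⊥ : TopologicalSpace.Opens X)) Empty.elim).2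
    (famSubeq_of_pieces (fun _ => Empty) (fun _ j => j.elim) (fun _ j => j.elim)
      (fun _ j => j.elim) (fun _ j => j.elim) (by simp) (fun _ j => j.elim) fun p => p.2.elim)
  simpa [familyMultiset] using this

theorem typeLE_singleton_sup (U V : TopologicalSpace.Opens X) :
    TypeLE G {U ⊔ V} ({U} + {V}) := by
  have := (typeLE_iff (G := G) (fun _ : Unit => U ⊔ V) (fun b : Bool => cond b U V)).2
    (famSubeq_of_pieces (fun _ => Bool) (fun _ b => (cond b U V : TopologicalSpace.Opens X))
      (fun _ _ => 1) (fun _ b => b) (fun _ b => TopologicalSpace.Opens.isOpen _)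
      (fun _ x hx => Set.mem_iUnion.2 (hx.elim (fun h => ⟨true, h⟩) fun h => ⟨false, h⟩))
      (fun _ b => by rw [one_smul]) (by
        rintro ⟨⟨⟩, a⟩ ⟨⟨⟩, b⟩ x hab _ _
        cases (show a = b from hab)
        rfl))
  simpa [familyMultiset] using this

theorem typeLE_add_sup {U V : TopologicalSpace.Opens X} (h : Disjoint (U : Set X) V) :
    TypeLE G ({U} + {V}) {U ⊔ V} := by
  have := (typeLE_iff (G := G) (fun b : Bool => cond b U V) (fun _ : Unit => U ⊔ V)).2
    (famSubeq_of_pieces (fun _ => Unit) (fun b _ => (cond b U V : TopologicalSpace.Opens X))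
      (fun _ _ => 1) (fun _ _ => ()) (fun b _ => TopologicalSpace.Opens.isOpen _)
      (fun b => (Set.iUnion_const _).ge)
      (fun b _ => by
        rw [one_smul]
        cases b
        exacts [Set.subset_union_right, Set.subset_union_left]) (by
        rintro ⟨a, ⟨⟩⟩ ⟨b, ⟨⟩⟩ x _ hx hy
        rw [one_smul] at hx hy
        cases a <;> cases b
        exacts [rfl, (Set.disjoint_left.1 h hy hx).elim, (Set.disjoint_left.1 h hx hy).elim, rfl]))
  simpa [familyMultiset] using this

theorem typeLE_singleton_familyMultiset {κ : Type} [Fintype κ] (B : κ → TopologicalSpace.Opens X)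
    (j : κ) : TypeLE G {B j} (familyMultiset B) := by
  have := (typeLE_iff (G := G) (fun _ : Unit => B j) B).2
    (famSubeq_of_subset (fun _ => (B j).isOpen) (fun _ => j) (Function.injective_of_subsingleton _)
      fun _ => subset_rfl)
  simpa [familyMultiset] using this

theorem isOpenValuation_of_state (D : Multiset (TopologicalSpace.Opens X) →+ ℝ≥0∞)
    (hD : ∀ M N, TypeLE G M N → D M ≤ D N) : IsOpenValuation G fun U => D {U} where
  mono _ _ h := hD _ _ (typeLE_singleton_of_le h)
  bot := le_antisymm ((hD _ _ typeLE_singleton_bot).trans (map_zero D).le) zero_le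
  sup_le U V := by rw [← map_add]; exact hD _ _ (typeLE_singleton_sup U V)
  le_sup U V h := by rw [← map_add]; exact hD _ _ (typeLE_add_sup h)
  inv g U V h := by
    refine le_antisymm (hD _ _ (typeLE_singleton_of_smul g⁻¹ ?_))
      (hD _ _ (typeLE_singleton_of_smul g h.ge))
    rw [h, inv_smul_smul]

theorem exists_typeLE_nsmul {ι κ : Type} [Fintype ι] [Fintype κ]
    (A : ι → TopologicalSpace.Opens X) (B : κ → TopologicalSpace.Opens X)
    (h : ∀ i, closure (A i : Set X) ⊆ ⋃ t : G × κ, t.1 • (B t.2 : Set X)) :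
    ∃ m : ℕ, TypeLE G (familyMultiset A) (m • familyMultiset B) := by
  classical
  let P : Multiset (TopologicalSpace.Opens X) → Prop := fun M =>
    ∃ m : ℕ, TypeLE G M (m • familyMultiset B)
  have hzero : P 0 := ⟨0, typeLE_zero _⟩
  have hadd : ∀ M N, P M → P N → P (M + N) := by
    rintro M N ⟨m, hm⟩ ⟨n, hn⟩
    exact ⟨m + n, by rw [add_smul]; exact hm.add hn⟩
  have hdown : ∀ {M N}, TypeLE G M N → P N → P M := by
    rintro M N hMN ⟨m, hm⟩
    exact ⟨m, hMN.trans hm⟩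
  have hsingle : ∀ i, P {A i} := by
    intro i
    obtain ⟨T, hT⟩ := isClosed_closure.isCompact.elim_finite_subcover _
      (fun t : G × κ => (B t.2).isOpen.smul t.1) (h i)
    let W : G × κ → TopologicalSpace.Opens X := fun t =>
      ⟨t.1 • (B t.2 : Set X), (B t.2).isOpen.smul t.1⟩
    have hW : ∀ t, P {W t} := fun t =>
      ⟨1, (typeLE_singleton_of_smul t.1⁻¹ (V := B t.2) (inv_smul_smul t.1 (B t.2 : Set X)).le).trans
        (by rw [one_smul]; exact typeLE_singleton_familyMultiset B t.2)⟩
    have hsup : ∀ T : Finset (G × κ), P {T.sup W} := by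
      intro T
      induction T using Finset.induction with
      | empty => exact hdown typeLE_singleton_bot hzero
      | insert t T _ ih =>
        rw [Finset.sup_insert]
        exact hdown (typeLE_singleton_sup _ _) (hadd _ _ (hW t) ih)
    refine hdown (typeLE_singleton_of_le fun x hx => ?_) (hsup T)
    obtain ⟨t, ht, hxt⟩ := Set.mem_iUnion₂.1 (hT (subset_closure hx))
    exact (Finset.le_sup (f := W) ht : W t ≤ _) hxt
  exact Finset.sum_induction _ P hadd hzero fun i _ => hsingle i

end TypeLE

/-- An invariant regular premeasure as an additive content. -/
noncomputable def InvRegPremeasure.addContent (μ : InvRegPremeasure X G) :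
    MeasureTheory.AddContent ℝ≥0∞ (MeasureTheory.generateSetAlgebra {t : Set X | IsOpen t}) :=
  MeasureTheory.isSetAlgebra_generateSetAlgebra.isSetRing.addContent_of_union μ.m μ.empty' (by
    intro s t hs ht hst
    have hmem : ∀ n : ℕ, InAlg X (if n = 0 then s else if n = 1 then t else ∅) := by
      intro n
      split_ifs
      exacts [hs, ht, inAlg_of_isOpen isOpen_empty]
    have hunion : (⋃ n : ℕ, if n = 0 then s else if n = 1 then t else ∅) = s ∪ t := by
      ext x
      simp only [Set.mem_iUnion, Set.mem_union]
      constructor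
      · rintro ⟨n, hn⟩
        split_ifs at hn
        exacts [Or.inl hn, Or.inr hn, hn.elim]
      · rintro (h | h)
        exacts [⟨0, by simpa using h⟩, ⟨1, by simpa using h⟩]
    have h := μ.countably_additive _ hmem ?_ ?_
    · rw [hunion, tsum_eq_sum (s := Finset.range 2)] at h
      · simpa [Finset.sum_range_succ] using h
      · intro n hn
        rw [Finset.mem_range] at hn
        rw [if_neg (by omega), if_neg (by omega), μ.empty']
    · intro a b hab
      simp only [Function.onFun]
      split_ifs <;> first | omega | simp [hst.symm]
    · rw [hunion]
      exact MeasureTheory.isSetAlgebra_generateSetAlgebra.union_mem hs ht)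

theorem InvRegPremeasure.sum_le_sum_of_famSubeq [T2Space X] [CompactSpace X]
    [ContinuousConstSMul G X] (μ : InvRegPremeasure X G) {ι κ : Type} [Fintype ι] [Fintype κ]
    {A : ι → Set X} {B : κ → Set X} (hA : ∀ i, IsOpen (A i)) (hB : ∀ j, IsOpen (B j))
    (h : FamSubeq G A B) : ∑ i, μ.m (A i) ≤ ∑ j, μ.m (B j) := by
  classical
  have hR := (MeasureTheory.isSetAlgebra_generateSetAlgebra
    (𝒜 := {t : Set X | IsOpen t})).isSetRing
  have hmono : ∀ {s t : Set X}, InAlg X s → InAlg X t → s ⊆ t → μ.m s ≤ μ.m t := fun hs ht hst =>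
    MeasureTheory.addContent_mono (m := μ.addContent) hR.isSetSemiring hs ht hst
  have hinner : ∀ i, μ.m (A i) ≤
      ⨆ F : {F : ι → Set X // ∀ i, IsClosed (F i) ∧ F i ⊆ A i}, μ.m (F.1 i) := by
    intro i
    rw [μ.inner_regular _ (inAlg_of_isOpen (hA i))]
    refine iSup₂_le fun K hK => ?_
    refine le_iSup_of_le ⟨Function.update (fun _ => ∅) i K, fun j => ?_⟩ (by simp)
    rcases eq_or_ne j i with rfl | hj
    · simpa using ⟨hK.1.isClosed, hK.2⟩
    · simp [hj]
  refine (Finset.sum_le_sum fun i _ => hinner i).trans ?_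
  rw [ENNReal.finsetSum_iSup]
  · refine iSup_le fun F => ?_
    obtain ⟨J, hJ, U, s, k, hU, hFU, hUB, hd⟩ := h F.1 F.2
    have := fun i => Fintype.ofFinite (J i)
    have hopen : ∀ p : Σ i, J i, IsOpen (s p.1 p.2 • U p.1 p.2) := fun p => (hU _ _).smul _
    calc ∑ i, μ.m (F.1 i) ≤ ∑ i, ∑ j : J i, μ.m (s i j • U i j) := by
          refine Finset.sum_le_sum fun i _ => ?_
          simp_rw [μ.invariant _ _ (inAlg_of_isOpen (hU i _))]
          refine (hmono (inAlg_of_isClosed (F.2 i).1)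
            (inAlg_of_isOpen (isOpen_biUnion fun j (_ : j ∈ Finset.univ) => hU i j)) ?_).trans
            (MeasureTheory.addContent_biUnion_le (m := μ.addContent) hR
              fun j _ => inAlg_of_isOpen (hU i j))
          simpa using hFU i
      _ = ∑ p : Σ i, J i, μ.m (s p.1 p.2 • U p.1 p.2) := by rw [Fintype.sum_sigma]
      _ = ∑ c, ∑ p : Σ i, J i with k p.1 p.2 = c, μ.m (s p.1 p.2 • U p.1 p.2) :=
          (Finset.sum_fiberwise _ _ _).symm
      _ ≤ ∑ c, μ.m (B c) := by
          refine Finset.sum_le_sum fun c _ => ?_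
          refine (MeasureTheory.addContent_biUnion_eq (m := μ.addContent) hR
            (fun p _ => inAlg_of_isOpen (hopen p)) ?_).ge.trans
            (hmono (inAlg_of_isOpen (isOpen_biUnion fun p _ => hopen p))
              (inAlg_of_isOpen (hB c)) ?_)
          · intro p hp q hq hpq
            simp only [Finset.coe_filter, Finset.mem_univ, true_and, Set.mem_ofPred_eq] at hp hq
            exact Set.disjoint_left.2 fun x hx hy => hpq (hd p q x (hp.trans hq.symm) hx hy)
          · refine Set.iUnion₂_subset fun p hp => ?_
            rw [← (Finset.mem_filter.1 hp).2]
            exact hUB _ _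
  · intro F F'
    refine ⟨⟨fun i => F.1 i ∪ F'.1 i, fun i =>
      ⟨(F.2 i).1.union (F'.2 i).1, Set.union_subset (F.2 i).2 (F'.2 i).2⟩⟩, fun i => ?_⟩
    have hi := inAlg_of_isClosed ((F.2 i).1.union (F'.2 i).1)
    exact ⟨hmono (inAlg_of_isClosed (F.2 i).1) hi Set.subset_union_left,
      hmono (inAlg_of_isClosed (F'.2 i).1) hi Set.subset_union_right⟩

theorem TypeLE.exists_smul_mem [T1Space X] {M N : Multiset (TopologicalSpace.Opens X)}
    (h : TypeLE G M N) {U : TopologicalSpace.Opens X} (hU : U ∈ M) {x : X} (hx : x ∈ U) :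
    ∃ V ∈ N, ∃ g : G, g • x ∈ V := by
  classical
  obtain ⟨i, hi⟩ := List.mem_iff_get.1 (Multiset.mem_toList.2 hU)
  obtain ⟨J, hJ, W, s, k, hW, hFW, hWN, -⟩ := h (Function.update (fun _ => ∅) i {x}) (by
    intro j
    rcases eq_or_ne j i with rfl | hj
    · simp only [Function.update_self, isClosed_singleton, true_and, Set.singleton_subset_iff]
      rw [hi]
      exact hx
    · simp [hj])
  obtain ⟨j, hj⟩ := Set.mem_iUnion.1 (hFW i (by simp : x ∈ _))
  exact ⟨_, Multiset.mem_toList.1 (List.get_mem _ (k i j)), s i j,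
    hWN i j (Set.smul_mem_smul_set hj)⟩

section Comparison

variable [CompactSpace X] [T2Space X] [ContinuousConstSMul G X]

theorem InvRegPremeasure.sum_map_le_of_typeLE (μ : InvRegPremeasure X G)
    {M N : Multiset (TopologicalSpace.Opens X)} (h : TypeLE G M N) :
    (M.map fun U : TopologicalSpace.Opens X => μ.m U).sum ≤
      (N.map fun U : TopologicalSpace.Opens X => μ.m U).sum := by
  have key : ∀ P : Multiset (TopologicalSpace.Opens X),
      ∑ i, μ.m (P.toList.get i) = (P.map fun U : TopologicalSpace.Opens X => μ.m U).sum := by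
    intro P
    conv_rhs => rw [← familyMultiset_toList_get P, familyMultiset_eq_map, Multiset.map_map]
    rfl
  rw [← key, ← key]
  exact μ.sum_le_sum_of_famSubeq (fun _ => TopologicalSpace.Opens.isOpen _)
    (fun _ => TopologicalSpace.Opens.isOpen _) h

theorem famSubeq_of_forall_measure_lt [TopologicalSpace.MetrizableSpace X]
    (hu : ∀ M N : Multiset (TopologicalSpace.Opens X),
      (∃ n : ℕ, TypeLE G ((n + 1) • M) (n • N)) → TypeLE G M N)
    {ι κ : Type} [Fintype ι] [Fintype κ] (A : ι → TopologicalSpace.Opens X)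
    (B : κ → TopologicalSpace.Opens X)
    (hAB : ∀ i, (A i : Set X) ⊆ ⋃ t : G × κ, t.1 • (B t.2 : Set X))
    (hμ : ∀ μ : InvRegPremeasure X G, ∑ j, μ.m (B j) = 1 → ∑ i, μ.m (A i) < ∑ j, μ.m (B j)) :
    FamSubeq G (fun i => (A i : Set X)) fun j => (B j : Set X) := by
  intro F hF
  have hA' : ∀ i, ∃ V : TopologicalSpace.Opens X, F i ⊆ V ∧ closure (V : Set X) ⊆ A i := by
    intro i
    obtain ⟨V, hV, hFV, hVA⟩ := normal_exists_closure_subset (hF i).1 (A i).isOpen (hF i).2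
    exact ⟨⟨V, hV⟩, hFV, hVA⟩
  choose A' hFA' hA'A using hA'
  suffices h : TypeLE G (familyMultiset A') (familyMultiset B) from
    (typeLE_iff A' B).1 h F fun i => ⟨(hF i).1, hFA' i⟩
  by_contra hnot
  obtain ⟨D, hD, hDA, hDB⟩ := exists_state (r := TypeLE G) typeLE_refl
    (fun _ _ _ => TypeLE.trans) typeLE_zero (fun _ _ _ _ => TypeLE.add)
    (exists_typeLE_nsmul A' B fun i => (hA'A i).trans (hAB i))
    (fun n hn => hnot (hu _ _ ⟨n, hn⟩))
  rw [familyMultiset, map_sum] at hDA hDB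
  have hd := isOpenValuation_of_state D hD
  set d : TopologicalSpace.Opens X → ℝ≥0∞ := fun U => D {U}
  have hc1 : ∑ j, innerValue d (B j) ≤ 1 :=
    (Finset.sum_le_sum fun j _ => hd.innerValue_le (B j)).trans hDB
  have hA1 : 1 ≤ ∑ i, innerValue d (A i) :=
    hDA.trans (Finset.sum_le_sum fun i _ => le_innerValue d (hA'A i))
  have hc0 : ∑ j, innerValue d (B j) ≠ 0 := by
    intro h0
    rw [Finset.sum_eq_zero_iff] at h0
    have hA0 : ∀ i, D {A' i} = 0 := by
      intro i
      refine le_antisymm ((hd.le_tsum_innerValue (fun t : G × κ => (B t.2).isOpen.smul t.1)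
        ((hA'A i).trans (hAB i))).trans ?_) zero_le
      simp [hd.innerValue_smul, h0]
    simp [hA0] at hDA
  set c := ∑ j, innerValue d (B j)
  have hctop : c ≠ ∞ := ne_top_of_le_ne_top ENNReal.one_ne_top hc1
  obtain ⟨μ, hμd⟩ := (hd.const_mul c⁻¹).exists_invRegPremeasure
  have hsum : ∀ {l : Type} [Fintype l] (C : l → TopologicalSpace.Opens X),
      ∑ i, μ.m (C i) = c⁻¹ * ∑ i, innerValue d (C i) := by
    intro l _ C
    rw [Finset.mul_sum]
    exact Finset.sum_congr rfl fun i _ => by rw [hμd _ (C i).isOpen, innerValue_const_mul]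
  have hB1 : ∑ j, μ.m (B j) = 1 := by rw [hsum, ENNReal.inv_mul_cancel hc0 hctop]
  have hlt := hμ μ hB1
  rw [hB1, hsum] at hlt
  refine hlt.not_ge ?_
  calc (1 : ℝ≥0∞) = 1 * 1 := (one_mul 1).symm
    _ ≤ c⁻¹ * ∑ i, innerValue d (A i) := mul_le_mul' (ENNReal.one_le_inv.2 hc1) hA1

theorem setSubeq_map_coe_iff (a b : List (TopologicalSpace.Opens X)) :
    SetSubeq G (a.map fun U : TopologicalSpace.Opens X => (U : Set X))
        (b.map fun U : TopologicalSpace.Opens X => (U : Set X)) ↔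
      TypeLE G (a : Multiset (TopologicalSpace.Opens X)) b := by
  have hopen : ∀ (l : List (TopologicalSpace.Opens X)) (i),
      IsOpen ((l.map fun U : TopologicalSpace.Opens X => (U : Set X)).get i) := by
    intro l i
    obtain ⟨U, -, hU⟩ := List.mem_map.1 (List.get_mem _ i)
    rw [← hU]
    exact U.isOpen
  rw [setSubeq_iff_famSubeq, ← familyMultiset_get a, ← familyMultiset_get b, typeLE_iff]
  exact famSubeq_congr (hopen a) (hopen b) (finCongr (List.length_map _))
    (finCongr (List.length_map _)) (by simp) (by simp)

end Comparison

theorem coe_flatten_replicate {α : Type*} (n : ℕ) (l : List α) :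
    ((List.replicate n l).flatten : Multiset α) = n • (l : Multiset α) := by
  induction n with
  | zero => simp
  | succ n ih =>
    rw [List.replicate_succ, List.flatten_cons, ← Multiset.coe_add, ih, succ_nsmul']

theorem exists_map_coe_opens {A : List (Set X)} (hA : ∀ s ∈ A, IsOpen s) :
    ∃ a : List (TopologicalSpace.Opens X),
      a.map (fun U : TopologicalSpace.Opens X => (U : Set X)) = A := by
  lift A to List {s : Set X // IsOpen s} using hA
  exact ⟨A.map fun s => ⟨s.1, s.2⟩, by simp [List.map_map, Function.comp_def]⟩

/-- The open support as an open set. -/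
def osuppOpens (f : C(X, ℝ≥0)) : TopologicalSpace.Opens X :=
  ⟨osupp f, isOpen_ne_fun f.continuous continuous_const⟩

theorem osuppOpens_surjective [TopologicalSpace.MetrizableSpace X] :
    Function.Surjective (osuppOpens (X := X)) := by
  intro U
  let _ : MetricSpace X := TopologicalSpace.metrizableSpaceMetric X
  rcases (U : Set X)ᶜ.eq_empty_or_nonempty with h | h
  · refine ⟨1, TopologicalSpace.Opens.ext ?_⟩
    rw [Set.compl_empty_iff.1 h]
    exact Set.eq_univ_of_forall fun x => one_ne_zero
  · refine ⟨⟨fun x => Metric.infNndist x (U : Set X)ᶜ, Metric.continuous_infNndist_pt _⟩,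
      TopologicalSpace.Opens.ext ?_⟩
    ext x
    change Metric.infNndist x (U : Set X)ᶜ ≠ 0 ↔ x ∈ (U : Set X)
    rw [← not_iff_not, not_not, ← Set.mem_compl_iff, ← NNReal.coe_eq_zero, Metric.coe_infNndist,
      U.isOpen.isClosed_compl.mem_iff_infDist_zero h]

theorem dynSubeq_iff [CompactSpace X] [T2Space X] [ContinuousConstSMul G X]
    (a b : List C(X, ℝ≥0)) :
    DynSubeq G a b ↔ TypeLE G (a.map osuppOpens : Multiset (TopologicalSpace.Opens X))
      (b.map osuppOpens : List (TopologicalSpace.Opens X)) := by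
  rw [← setSubeq_map_coe_iff, List.map_map, List.map_map]
  rfl

theorem forall_typeLE_of_forall_dynSubeq [CompactSpace X] [T2Space X]
    [TopologicalSpace.MetrizableSpace X] [ContinuousConstSMul G X]
    (hu : ∀ a b : List C(X, ℝ≥0),
      (∃ n : ℕ, DynSubeq G (List.flatten (List.replicate (n + 1) a))
        (List.flatten (List.replicate n b))) → DynSubeq G a b)
    (M N : Multiset (TopologicalSpace.Opens X)) (h : ∃ n : ℕ, TypeLE G ((n + 1) • M) (n • N)) :
    TypeLE G M N := by
  induction M using Quotient.inductionOn with | _ a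
  induction N using Quotient.inductionOn with | _ b
  obtain ⟨a, rfl⟩ := (List.map_surjective_iff.2 osuppOpens_surjective) a
  obtain ⟨b, rfl⟩ := (List.map_surjective_iff.2 osuppOpens_surjective) b
  refine (dynSubeq_iff a b).1 (hu a b (h.imp fun n hn => ?_))
  rw [dynSubeq_iff, List.map_flatten, List.map_flatten, List.map_replicate, List.map_replicate,
    coe_flatten_replicate, coe_flatten_replicate]
  exact hn

/-- **Theorem A (Corollary 3.10).** `W(X, G)` is almost unperforated — i.e.
`(n+1)x ≤ ny` for some `n ∈ ℕ` implies `x ≤ y` — iff for any two finite sequences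
`(A₁, …, A_k)` and `(B₁, …, B_l)` of open sets with `⋃ᵢ Aᵢ ⊆ G ⋅ (⋃ⱼ Bⱼ)` and
`Σᵢ μ(Aᵢ) < Σⱼ μ(Bⱼ)` for every `μ ∈ Pr_G(X)` with `Σⱼ μ(Bⱼ) = 1`, one has
`⨆ᵢ Aᵢ × {i} ≺ ⨆ⱼ Bⱼ × {j}`. -/
theorem almost_unperforated_iff_open_comparison {X : Type*} [TopologicalSpace X]
    [CompactSpace X] [T2Space X] [TopologicalSpace.MetrizableSpace X]
    {G : Type*} [Group G] [MulAction G X]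
    (hG : ∀ g : G, Continuous fun x : X => g • x) :
    (∀ a b : List C(X, ℝ≥0),
      (∃ n : ℕ, DynSubeq G (List.flatten (List.replicate (n + 1) a))
        (List.flatten (List.replicate n b))) →
      DynSubeq G a b) ↔
    (∀ A B : List (Set X), (∀ s ∈ A, IsOpen s) → (∀ s ∈ B, IsOpen s) →
      ((⋃ i : Fin A.length, A.get i) ⊆ ⋃ g : G, g • ⋃ j : Fin B.length, B.get j) →
      (∀ μ : InvRegPremeasure X G, (∑ j : Fin B.length, μ.m (B.get j)) = 1 →
        (∑ i : Fin A.length, μ.m (A.get i)) < ∑ j : Fin B.length, μ.m (B.get j)) →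
      SetSubeq G A B) := by
  have : ContinuousConstSMul G X := ⟨hG⟩
  constructor
  · intro hu A B hA hB hAB hμ
    obtain ⟨a, rfl⟩ := exists_map_coe_opens hA
    obtain ⟨b, rfl⟩ := exists_map_coe_opens hB
    have hsum : ∀ (μ : InvRegPremeasure X G) (l : List (TopologicalSpace.Opens X)),
        ∑ i, μ.m ((l.map fun U : TopologicalSpace.Opens X => (U : Set X)).get i) =
          ∑ i, μ.m (l.get i) := by
      intro μ l
      exact Fintype.sum_equiv (finCongr (List.length_map _)) _ _ (by simp)
    rw [setSubeq_map_coe_iff, ← familyMultiset_get a, ← familyMultiset_get b, typeLE_iff]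
    refine famSubeq_of_forall_measure_lt (forall_typeLE_of_forall_dynSubeq hu) _ _
      (fun i x hx => ?_) fun μ hμB => ?_
    · have hx' : x ∈ ⋃ i, (a.map fun U : TopologicalSpace.Opens X => (U : Set X)).get i :=
        Set.mem_iUnion.2 ⟨(finCongr (List.length_map _)).symm i, by simpa using hx⟩
      obtain ⟨g, y, hy, rfl⟩ := Set.mem_iUnion.1 (hAB hx')
      obtain ⟨j, hj⟩ := Set.mem_iUnion.1 hy
      exact Set.mem_iUnion.2 ⟨(g, finCongr (List.length_map _) j),
        Set.smul_mem_smul_set (by simpa using hj)⟩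
    · rw [← hsum, ← hsum]
      exact hμ μ ((hsum μ b).trans hμB)
  · rintro h a b ⟨n, hn⟩
    rw [dynSubeq_iff, List.map_flatten, List.map_flatten, List.map_replicate, List.map_replicate,
      coe_flatten_replicate, coe_flatten_replicate] at hn
    have hopen : ∀ l : List C(X, ℝ≥0), ∀ s ∈ l.map osupp, IsOpen s := by
      intro l s hs
      obtain ⟨f, -, rfl⟩ := List.mem_map.1 hs
      exact (osuppOpens f).isOpen
    have hsum : ∀ (μ : InvRegPremeasure X G) (l : List C(X, ℝ≥0)),
        ∑ i, μ.m ((l.map osupp).get i) =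
          (((l.map osuppOpens : List _) : Multiset (TopologicalSpace.Opens X)).map
            fun U : TopologicalSpace.Opens X => μ.m U).sum := by
      intro μ l
      rw [Multiset.map_coe, Multiset.sum_coe, List.map_map, ← Fin.sum_univ_fun_getElem]
      exact Fintype.sum_equiv (finCongr (List.length_map _)) _ _ fun i => by
        simp only [List.get_eq_getElem, List.getElem_map]
        rfl
    refine h _ _ (hopen a) (hopen b) (fun x hx => ?_) fun μ hμ => ?_
    · obtain ⟨i, hi⟩ := Set.mem_iUnion.1 hx
      obtain ⟨f, hf, hfi⟩ := List.mem_map.1 (List.get_mem _ i)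
      rw [← hfi] at hi
      obtain ⟨V, hV, g, hg⟩ := hn.exists_smul_mem (U := osuppOpens f)
        ((Multiset.mem_nsmul_of_ne_zero n.succ_ne_zero).2
          (Multiset.mem_coe.2 (List.mem_map_of_mem hf))) hi
      obtain ⟨f', hf', rfl⟩ := List.mem_map.1 (Multiset.mem_coe.1 (Multiset.mem_of_mem_nsmul hV))
      obtain ⟨j, hj⟩ := List.mem_iff_get.1 (List.mem_map_of_mem (f := osupp) hf')
      refine Set.mem_iUnion.2 ⟨g⁻¹, ?_⟩
      rw [Set.mem_inv_smul_set_iff]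
      exact Set.mem_iUnion.2 ⟨j, hj ▸ hg⟩
    · rw [hμ]
      by_contra hle
      have hn' := μ.sum_map_le_of_typeLE hn
      rw [Multiset.map_nsmul, Multiset.map_nsmul, Multiset.sum_nsmul, Multiset.sum_nsmul, ← hsum,
        ← hsum, hμ, nsmul_one] at hn'
      have h1 : ((n + 1 : ℕ) : ℝ≥0∞) ≤ n := by
        rw [← nsmul_one]
        exact (nsmul_le_nsmul_right (not_lt.1 hle) _).trans hn'
      exact absurd (Nat.cast_le.1 h1) (by omega)
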